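/- arXiv:2110.12762 — 2 statements merged into one kernel-verified Lean document; each statement's English description precedes it below -/
import Mathlib

section
/- Let (f_n)_{n≥1} be a sequence of piecewise Lipschitz functions on (−1,1), each extended by zero to ℝ, with M := sup_n ‖f_n‖_{L∞(−1,1)} < ∞. Set β := (1/π)·arctan M ∈ [0, 1/2), τ_n := 𝓗(arctan∘f_n), and t_n(x) := e^{τ_n(x)}/(π·√(1−x²)·√(1+f_n(x)²)) for x ∈ (−1,1). Then for every q ∈ (1, (1/2+β)^{−1}) there exists a constant C (independent of n) such that ∫_{−1}^1 t_n(x)^q dx ≤ C for all n, i.e. the sequence (t_n) is bounded in L^q(−1,1). -/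
open MeasureTheory Filter Set
open scoped Real Topology ENNReal

/-- Hilbert transform: `HT h x = -(1/π) · lim_{ε→0⁺} ∫_{|x-s|>ε} h(s)/(x-s) ds`. -/
noncomputable def HT (h : ℝ → ℝ) (x : ℝ) : ℝ :=
  limUnder (𝓝[>] (0:ℝ)) (fun ε : ℝ =>
    -(1 / Real.pi) * ∫ s in {s : ℝ | ε < |x - s|}, h s / (x - s))

/-- A piecewise Lipschitz function on `(-1,1)`. -/
def PiecewiseLipschitzOn (f : ℝ → ℝ) : Prop :=
  ∃ (m : ℕ) (y : ℕ → ℝ), 0 < m ∧ y 0 = -1 ∧ y m = 1 ∧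
    (∀ j, j < m → y j < y (j + 1)) ∧
    ∀ j, j < m → ∃ K : NNReal, LipschitzOnWith K f (Set.Ioo (y j) (y (j + 1)))

/-- Regularizations of the odd kernel `1/u` against a bounded function supported in `(-1,1)` all
converge, at a point of local Lipschitz continuity, to the same limit. -/
theorem tendsto_integral_mul_odd_kernel {φ : ℝ → ℝ} (hm : AEStronglyMeasurable φ volume) {B : ℝ}
    (hB : ∀ s, |φ s| ≤ B) (h0 : ∀ s ∉ Ioo (-1 : ℝ) 1, φ s = 0) {x K δ : ℝ} (hK : 0 ≤ K)
    (hδ : 0 < δ) (hL : ∀ s, |s - x| ≤ δ → |φ s - φ x| ≤ K * |s - x|) {k : ℝ → ℝ → ℝ}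
    (hkm : ∀ ε, Measurable (k ε)) (hodd : ∀ ε u, k ε (-u) = -k ε u)
    (hk1 : ∀ ε, 0 < ε → ∀ u, |k ε u * u| ≤ 1) (hk2 : ∀ ε, 0 < ε → ∀ u, |k ε u| ≤ 1 / ε)
    (hlim : ∀ u, u ≠ 0 → Tendsto (fun ε => k ε u * u) (𝓝[>] 0) (𝓝 1)) :
    Tendsto (fun ε => ∫ s, φ s * k ε (x - s)) (𝓝[>] 0)
      (𝓝 (∫ s, (φ s - (Ioc (x - δ) (x + δ)).indicator (fun _ => φ x) s) / (x - s))) := by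
  set ψ : ℝ → ℝ := fun s => φ s - (Ioc (x - δ) (x + δ)).indicator (fun _ => φ x) s with hψ
  have hB0 : 0 ≤ B := (abs_nonneg _).trans (hB 0)
  have hψm : AEStronglyMeasurable ψ volume :=
    hm.sub ((stronglyMeasurable_const.indicator measurableSet_Ioc).aestronglyMeasurable)
  have hψb : ∀ s, |ψ s| ≤ (K + B / δ) * |x - s| := by
    intro s
    rw [abs_sub_comm x s]
    have hd : 0 ≤ B / δ * |s - x| := by positivity
    have hd' : 0 ≤ K * |s - x| := by positivity
    by_cases hs : s ∈ Ioc (x - δ) (x + δ)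
    · have : |φ s - φ x| ≤ K * |s - x| :=
        hL s (abs_le.2 ⟨by linarith [hs.1], by linarith [hs.2]⟩)
      simp only [hψ, indicator_of_mem hs]
      linarith
    · have h1 : δ ≤ |s - x| := by
        by_contra! h
        have := abs_lt.1 h
        exact hs ⟨by linarith, by linarith⟩
      have h2 : B ≤ B / δ * |s - x| := by
        rw [div_mul_eq_mul_div, le_div_iff₀ hδ]
        exact mul_le_mul_of_nonneg_left h1 hB0
      simp only [hψ, indicator_of_notMem hs, sub_zero]
      linarith [hB s]
  set S : Set ℝ := Icc (-1 - |x| - δ) (1 + |x| + δ)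
  have hψ0 : ∀ s ∉ S, ψ s = 0 := by
    intro s hs
    have hx1 := le_abs_self x
    have hx2 := neg_abs_le x
    have h1 : s ∉ Ioo (-1 : ℝ) 1 := fun h => hs ⟨by linarith [h.1, abs_nonneg x], by
      linarith [h.2, abs_nonneg x]⟩
    have h2 : s ∉ Ioc (x - δ) (x + δ) := fun h => hs ⟨by linarith [h.1], by linarith [h.2]⟩
    simp [hψ, h0 s h1, indicator_of_notMem h2]
  have hkx : ∀ ε, Measurable (fun s => k ε (x - s)) := fun ε =>
    (hkm ε).comp (measurable_const.sub measurable_id)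
  have hbd : Integrable (S.indicator (fun _ => K + B / δ)) volume :=
    (integrable_indicator_iff measurableSet_Icc).2 (integrableOn_const (by simp))
  have hdom : ∀ ε, 0 < ε → ∀ s, ‖ψ s * k ε (x - s)‖ ≤ S.indicator (fun _ => K + B / δ) s := by
    intro ε hε s
    by_cases hs : s ∈ S
    · rw [indicator_of_mem hs, Real.norm_eq_abs, abs_mul]
      have h1 := hk1 ε hε (x - s)
      rw [abs_mul] at h1
      calc |ψ s| * |k ε (x - s)| ≤ (K + B / δ) * |x - s| * |k ε (x - s)| := by
            gcongr
            exact hψb s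
        _ = (K + B / δ) * (|k ε (x - s)| * |x - s|) := by ring
        _ ≤ (K + B / δ) * 1 := by gcongr
        _ = _ := mul_one _
    · simp [indicator_of_notMem hs, hψ0 s hs]
  have hψk : ∀ ε, AEStronglyMeasurable (fun s => ψ s * k ε (x - s)) volume := fun ε =>
    hψm.mul (hkx ε).aestronglyMeasurable
  have hsplit : ∀ ε, 0 < ε → ∫ s, φ s * k ε (x - s) = ∫ s, ψ s * k ε (x - s) := by
    intro ε hε
    have hzero : ∫ s in (x - δ)..(x + δ), k ε (x - s) = 0 := by
      rw [intervalIntegral.integral_comp_sub_left (fun u => k ε u) x]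
      have e1 : x - (x + δ) = -δ := by ring
      have e2 : x - (x - δ) = δ := by ring
      rw [e1, e2]
      have := intervalIntegral.integral_comp_neg (a := -δ) (b := δ) (fun u => k ε u)
      simp only [hodd, intervalIntegral.integral_neg, neg_neg] at this
      linarith
    have hint2 : Integrable (fun s => (Ioc (x - δ) (x + δ)).indicator
        (fun s => φ x * k ε (x - s)) s) volume := by
      refine (integrable_indicator_iff measurableSet_Ioc).2 ?_
      refine Integrable.of_bound ((hkx ε).const_mul _).aestronglyMeasurable (B * (1 / ε))
        (ae_of_all _ fun s => ?_)
      rw [Real.norm_eq_abs, abs_mul]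
      exact mul_le_mul (hB x) (hk2 ε hε _) (abs_nonneg _) hB0
    have hint1 : Integrable (fun s => ψ s * k ε (x - s)) volume :=
      hbd.mono' (hψk ε) (ae_of_all _ (hdom ε hε))
    have heq : (fun s => φ s * k ε (x - s)) = fun s => ψ s * k ε (x - s) +
        (Ioc (x - δ) (x + δ)).indicator (fun s => φ x * k ε (x - s)) s := by
      funext s
      by_cases hs : s ∈ Ioc (x - δ) (x + δ)
      · simp only [hψ, indicator_of_mem hs]; ring
      · simp only [hψ, indicator_of_notMem hs]; ring
    rw [heq, integral_add hint1 hint2, integral_indicator measurableSet_Ioc,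
      ← intervalIntegral.integral_of_le (by linarith), intervalIntegral.integral_const_mul, hzero]
    ring
  have hmain : Tendsto (fun ε => ∫ s, ψ s * k ε (x - s)) (𝓝[>] 0) (𝓝 (∫ s, ψ s / (x - s))) := by
    refine tendsto_integral_filter_of_dominated_convergence _ (Eventually.of_forall hψk)
      (eventually_mem_nhdsWithin.mono fun ε hε => ae_of_all _ (hdom ε hε)) hbd ?_
    have hne : ∀ᵐ s : ℝ, s ≠ x := by simp [ae_iff, measure_singleton]
    filter_upwards [hne] with s hs
    have hxs : x - s ≠ 0 := sub_ne_zero.2 (Ne.symm hs)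
    have h1 := (hlim _ hxs).const_mul (ψ s / (x - s))
    rw [mul_one] at h1
    refine h1.congr fun ε => ?_
    field_simp
  exact hmain.congr' (eventually_mem_nhdsWithin.mono fun ε hε => (hsplit ε hε).symm)

theorem tendsto_truncated_kernel {φ : ℝ → ℝ} (hm : AEStronglyMeasurable φ volume) {B : ℝ}
    (hB : ∀ s, |φ s| ≤ B) (h0 : ∀ s ∉ Ioo (-1 : ℝ) 1, φ s = 0) {x K δ : ℝ} (hK : 0 ≤ K)
    (hδ : 0 < δ) (hL : ∀ s, |s - x| ≤ δ → |φ s - φ x| ≤ K * |s - x|) :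
    Tendsto (fun ε => ∫ s in {s : ℝ | ε < |x - s|}, φ s / (x - s)) (𝓝[>] 0)
      (𝓝 (∫ s, (φ s - (Ioc (x - δ) (x + δ)).indicator (fun _ => φ x) s) / (x - s))) := by
  have hU : ∀ ε : ℝ, MeasurableSet {u : ℝ | ε < |u|} := fun ε =>
    measurableSet_lt measurable_const measurable_norm
  refine (tendsto_integral_mul_odd_kernel hm hB h0 hK hδ hL
    (k := fun ε => {u : ℝ | ε < |u|}.indicator fun u => u⁻¹) ?_ ?_ ?_ ?_ ?_).congr ?_
  · exact fun ε => measurable_inv.indicator (hU ε)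
  · intro ε u
    simp only [indicator_apply, mem_ofPred_eq, abs_neg, inv_neg]
    split_ifs <;> simp
  · intro ε hε u
    by_cases hu : ε < |u|
    · have : u ≠ 0 := abs_pos.1 (hε.trans hu)
      simp [hu, this]
    · simp [hu]
  · intro ε hε u
    by_cases hu : ε < |u|
    · simp only [indicator_apply, mem_ofPred_eq, hu, if_true, abs_inv, one_div]
      gcongr
    · simp [hu, hε.le]
  · intro u hu
    refine tendsto_const_nhds.congr' ?_
    filter_upwards [Ioo_mem_nhdsGT (abs_pos.2 hu)] with ε hε
    simp [hε.2, hu]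
  · intro ε
    have hU' : MeasurableSet {s : ℝ | ε < |x - s|} :=
      measurableSet_lt measurable_const (measurable_const.sub measurable_id).norm
    rw [← integral_indicator hU']
    congr 1
    funext s
    by_cases hs : ε < |x - s| <;> simp [hs, div_eq_mul_inv]

theorem tendsto_conjugate_poisson_kernel {φ : ℝ → ℝ} (hm : AEStronglyMeasurable φ volume) {B : ℝ}
    (hB : ∀ s, |φ s| ≤ B) (h0 : ∀ s ∉ Ioo (-1 : ℝ) 1, φ s = 0) {x K δ : ℝ} (hK : 0 ≤ K)
    (hδ : 0 < δ) (hL : ∀ s, |s - x| ≤ δ → |φ s - φ x| ≤ K * |s - x|) :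
    Tendsto (fun ε : ℝ => ∫ s, φ s * ((x - s) / ((x - s) ^ 2 + ε ^ 2))) (𝓝[>] 0)
      (𝓝 (∫ s, (φ s - (Ioc (x - δ) (x + δ)).indicator (fun _ => φ x) s) / (x - s))) := by
  refine tendsto_integral_mul_odd_kernel hm hB h0 hK hδ hL
    (k := fun ε u => u / (u ^ 2 + ε ^ 2)) ?_ ?_ ?_ ?_ ?_
  · intro ε
    fun_prop
  · intro ε u
    rw [neg_sq, neg_div]
  · intro ε hε u
    rw [div_mul_eq_mul_div, abs_div, abs_of_pos (a := u ^ 2 + ε ^ 2) (by positivity),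
      div_le_one (by positivity), ← sq, abs_of_nonneg (sq_nonneg u)]
    linarith [sq_nonneg ε]
  · intro ε hε u
    rw [abs_div, abs_of_pos (a := u ^ 2 + ε ^ 2) (by positivity), div_le_div_iff₀ (by positivity) hε]
    nlinarith [sq_nonneg (|u| - ε), sq_abs u, abs_nonneg u]
  · intro u hu
    have hc : ContinuousAt (fun ε : ℝ => u / (u ^ 2 + ε ^ 2) * u) 0 := by
      refine ContinuousAt.mul (ContinuousAt.div (by fun_prop) (by fun_prop) ?_) (by fun_prop)
      positivity
    have := hc.tendsto
    simp only [ne_eq, OfNat.ofNat_ne_zero, not_false_eq_true, zero_pow, add_zero] at this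
    have e : u / u ^ 2 * u = 1 := by field_simp
    rw [e] at this
    exact this.mono_left nhdsWithin_le_nhds

/-- The analytic function on the upper half-plane whose boundary values on `(-1,1)` are
`HT φ + i φ`. -/
noncomputable def cauchyExtension (φ : ℝ → ℝ) (z : ℂ) : ℂ :=
  -(1 / (π : ℂ)) * ∫ s in Ioo (-1 : ℝ) 1, (φ s : ℂ) / (z - s)

theorem im_le_norm_sub_ofReal (z : ℂ) (s : ℝ) : z.im ≤ ‖z - s‖ := by
  have := Complex.abs_im_le_norm (z - s)
  simp only [Complex.sub_im, Complex.ofReal_im, sub_zero] at this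
  exact (le_abs_self _).trans this

theorem sub_ofReal_ne_zero {z : ℂ} (hz : 0 < z.im) (s : ℝ) : z - s ≠ 0 :=
  norm_pos_iff.1 (hz.trans_le (im_le_norm_sub_ofReal z s))

theorem aestronglyMeasurable_div_sub_pow {φ : ℝ → ℝ} (hm : AEStronglyMeasurable φ volume)
    (z : ℂ) (n : ℕ) : AEStronglyMeasurable (fun s : ℝ => (φ s : ℂ) / (z - s) ^ n)
      (volume.restrict (Ioo (-1 : ℝ) 1)) := by
  have h1 : AEStronglyMeasurable (fun s : ℝ => (φ s : ℂ)) (volume.restrict (Ioo (-1 : ℝ) 1)) :=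
    Complex.continuous_ofReal.comp_aestronglyMeasurable hm.restrict
  have h2 : Measurable (fun s : ℝ => ((z - s) ^ n)⁻¹) := by fun_prop
  exact h1.mul h2.aestronglyMeasurable

theorem integrable_div_sub {φ : ℝ → ℝ} (hm : AEStronglyMeasurable φ volume) {B : ℝ}
    (hB : ∀ s, |φ s| ≤ B) {z : ℂ} (hz : 0 < z.im) :
    Integrable (fun s : ℝ => (φ s : ℂ) / (z - s)) (volume.restrict (Ioo (-1 : ℝ) 1)) := by
  have h := aestronglyMeasurable_div_sub_pow hm z 1
  simp only [pow_one] at h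
  refine Integrable.of_bound h (B / z.im) (ae_of_all _ fun s => ?_)
  rw [norm_div, Complex.norm_real, Real.norm_eq_abs]
  have hB0 : 0 ≤ B := (abs_nonneg _).trans (hB 0)
  gcongr
  · exact hB s
  · exact im_le_norm_sub_ofReal z s

theorem differentiableAt_cauchyExtension {φ : ℝ → ℝ} (hm : AEStronglyMeasurable φ volume) {B : ℝ}
    (hB : ∀ s, |φ s| ≤ B) {z : ℂ} (hz : 0 < z.im) :
    DifferentiableAt ℂ (cauchyExtension φ) z := by
  have hB0 : 0 ≤ B := (abs_nonneg _).trans (hB 0)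
  have hU : {w : ℂ | z.im / 2 < w.im} ∈ 𝓝 z :=
    (isOpen_lt continuous_const Complex.continuous_im).mem_nhds (half_lt_self hz)
  have hpos : ∀ w ∈ {w : ℂ | z.im / 2 < w.im}, 0 < w.im := fun w hw => (half_pos hz).trans hw
  have key := hasDerivAt_integral_of_dominated_loc_of_deriv_le
    (μ := volume.restrict (Ioo (-1 : ℝ) 1)) (𝕜 := ℂ)
    (F := fun w (s : ℝ) => (φ s : ℂ) / (w - s)) (F' := fun w (s : ℝ) => -((φ s : ℂ) / (w - s) ^ 2))
    (x₀ := z) (s := {w : ℂ | z.im / 2 < w.im}) (bound := fun _ => B / (z.im / 2) ^ 2) hU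
    (Eventually.of_forall fun w => by simpa using aestronglyMeasurable_div_sub_pow hm w 1)
    (integrable_div_sub hm hB hz) (aestronglyMeasurable_div_sub_pow hm z 2).neg
    (ae_of_all _ fun s w hw => ?_) (integrable_const _) (ae_of_all _ fun s w hw => ?_)
  · exact (key.2.differentiableAt).const_mul _
  · rw [norm_neg, norm_div, norm_pow, Complex.norm_real, Real.norm_eq_abs]
    have h1 := im_le_norm_sub_ofReal w s
    have h2 : z.im / 2 < w.im := hw
    gcongr
    · exact hB s
    · linarith
  · have h1 := ((hasDerivAt_id w).sub_const (s : ℂ)).inv (sub_ofReal_ne_zero (hpos w hw) s)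
    have h2 := h1.const_mul (φ s : ℂ)
    refine h2.congr_deriv ?_
    simp only [id]
    ring

theorem cauchyExtension_re {φ : ℝ → ℝ} (hm : AEStronglyMeasurable φ volume) {B : ℝ}
    (hB : ∀ s, |φ s| ≤ B) (x : ℝ) {y : ℝ} (hy : 0 < y) :
    (cauchyExtension φ (x + y * Complex.I)).re =
      -(1 / π) * ∫ s in Ioo (-1 : ℝ) 1, φ s * ((x - s) / ((x - s) ^ 2 + y ^ 2)) := by
  have hz : 0 < ((x : ℂ) + y * Complex.I).im := by simpa using hy
  have h := integral_re (integrable_div_sub hm hB hz)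
  have e : -(1 / (π : ℂ)) = ((-(1 / π) : ℝ) : ℂ) := by push_cast; rfl
  rw [cauchyExtension, e, Complex.re_ofReal_mul]
  congr 1
  refine h.symm.trans (integral_congr_ae (ae_of_all _ fun s => ?_))
  simp [Complex.div_re, Complex.normSq_apply]
  ring_nf

theorem cauchyExtension_im {φ : ℝ → ℝ} (hm : AEStronglyMeasurable φ volume) {B : ℝ}
    (hB : ∀ s, |φ s| ≤ B) (x : ℝ) {y : ℝ} (hy : 0 < y) :
    (cauchyExtension φ (x + y * Complex.I)).im =
      (1 / π) * ∫ s in Ioo (-1 : ℝ) 1, φ s * (y / ((x - s) ^ 2 + y ^ 2)) := by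
  have hz : 0 < ((x : ℂ) + y * Complex.I).im := by simpa using hy
  have h := integral_im (integrable_div_sub hm hB hz)
  have e : -(1 / (π : ℂ)) = ((-(1 / π) : ℝ) : ℂ) := by push_cast; rfl
  rw [cauchyExtension, e, Complex.im_ofReal_mul, neg_mul, ← mul_neg]
  congr 1
  have h' : (∫ s in Ioo (-1 : ℝ) 1, (φ s : ℂ) / (x + y * Complex.I - s)).im =
      ∫ s in Ioo (-1 : ℝ) 1, -(φ s * (y / ((x - s) ^ 2 + y ^ 2))) := by
    refine h.symm.trans (integral_congr_ae (ae_of_all _ fun s => ?_))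
    simp [Complex.div_im, Complex.normSq_apply]
    ring_nf
  rw [h', integral_neg, neg_neg]

theorem integral_poisson_kernel (x : ℝ) {y : ℝ} (hy : 0 < y) :
    ∫ s in Ioo (-1 : ℝ) 1, y / ((x - s) ^ 2 + y ^ 2) =
      Real.arctan ((1 + x) / y) + Real.arctan ((1 - x) / y) := by
  rw [← integral_Ioc_eq_integral_Ioo, ← intervalIntegral.integral_of_le (by norm_num),
    intervalIntegral.integral_eq_sub_of_hasDerivAt (f := fun s => Real.arctan ((s - x) / y))]
  · have e : (-1 - x) / y = -((1 + x) / y) := by ring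
    rw [e, Real.arctan_neg]
    ring
  · intro s _
    have h := (((hasDerivAt_id s).sub_const x).div_const y).arctan
    refine h.congr_deriv ?_
    have h2 : 1 + ((s - x) / y) ^ 2 ≠ 0 := by positivity
    have h3 : (x - s) ^ 2 + y ^ 2 ≠ 0 := by positivity
    simp only [id]
    field_simp
    ring
  · refine Continuous.intervalIntegrable ?_ _ _
    refine Continuous.div (by fun_prop) (by fun_prop) fun s => ?_
    positivity

/-- The imaginary part at a point is controlled by the angle under which `(-1,1)` is seen. -/
theorem abs_cauchyExtension_im_le {φ : ℝ → ℝ} (hm : AEStronglyMeasurable φ volume) {β : ℝ}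
    (hB : ∀ s, |φ s| ≤ π * β) (x : ℝ) {y : ℝ} (hy : 0 < y) :
    |(cauchyExtension φ (x + y * Complex.I)).im| ≤
      β * (Real.arctan ((1 + x) / y) + Real.arctan ((1 - x) / y)) := by
  rw [cauchyExtension_im hm hB x hy, ← integral_poisson_kernel x hy, abs_mul,
    abs_of_pos (a := 1 / π) (by positivity)]
  have hc : Continuous fun s : ℝ => y / ((x - s) ^ 2 + y ^ 2) :=
    Continuous.div (by fun_prop) (by fun_prop) fun s => by positivity
  have h : ‖∫ s in Ioo (-1 : ℝ) 1, φ s * (y / ((x - s) ^ 2 + y ^ 2))‖ ≤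
      ∫ s in Ioo (-1 : ℝ) 1, π * β * (y / ((x - s) ^ 2 + y ^ 2)) := by
    refine norm_integral_le_of_norm_le ?_ (ae_of_all _ fun s => ?_)
    · exact ((hc.const_mul _).continuousOn.integrableOn_Icc).mono_set Ioo_subset_Icc_self
    · have hp : 0 ≤ y / ((x - s) ^ 2 + y ^ 2) := by positivity
      rw [norm_mul, Real.norm_eq_abs, Real.norm_eq_abs, abs_of_nonneg hp]
      exact mul_le_mul_of_nonneg_right (hB s) hp
  rw [integral_const_mul, Real.norm_eq_abs] at h
  calc _ ≤ 1 / π * (π * β * _) := by gcongr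
    _ = _ := by field_simp

theorem norm_cauchyExtension_le {φ : ℝ → ℝ} {β : ℝ} (hB : ∀ s, |φ s| ≤ π * β) {z : ℂ}
    (hz : ∀ s ∈ Ioo (-1 : ℝ) 1, 1 ≤ ‖z - s‖) : ‖cauchyExtension φ z‖ ≤ 2 * β := by
  have h : ‖∫ s in Ioo (-1 : ℝ) 1, (φ s : ℂ) / (z - s)‖ ≤
      π * β * volume.real (Ioo (-1 : ℝ) 1) := by
    refine norm_setIntegral_le_of_norm_le_const (by simp) fun s hs => ?_
    rw [norm_div, Complex.norm_real, Real.norm_eq_abs]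
    exact (div_le_self (abs_nonneg _) (hz s hs)).trans (hB s)
  have hv : volume.real (Ioo (-1 : ℝ) 1) = 2 := by
    rw [Real.volume_real_Ioo_of_le (by norm_num)]; norm_num
  rw [hv] at h
  have e : ‖-(1 / (π : ℂ))‖ = 1 / π := by
    rw [norm_neg, norm_div, norm_one, Complex.norm_real, Real.norm_eq_abs, abs_of_pos Real.pi_pos]
  rw [cauchyExtension, norm_mul, e]
  calc _ ≤ 1 / π * (π * β * 2) := by gcongr
    _ = _ := by field_simp

theorem cauchyExtension_re_le {φ : ℝ → ℝ} (hm : AEStronglyMeasurable φ volume) {β : ℝ}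
    (hβ : 0 ≤ β) (hB : ∀ s, |φ s| ≤ π * β) {x : ℝ} (hx : 1 < |x|) {y : ℝ} (hy : 0 < y) :
    (cauchyExtension φ (x + y * Complex.I)).re ≤
      β * (Real.log (|x| + 1) - Real.log (|x| - 1)) := by
  have hne : ∀ s ∈ Icc (-1 : ℝ) 1, x - s ≠ 0 := by
    intro s hs h
    rw [sub_eq_zero.1 h] at hx
    exact absurd (abs_le.2 hs) (not_le.2 hx)
  have hc : ContinuousOn (fun s : ℝ => |x - s|⁻¹) (Icc (-1) 1) :=
    ContinuousOn.inv₀ (by fun_prop) fun s hs => abs_ne_zero.2 (hne s hs)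
  have hval : ∫ s in Ioo (-1 : ℝ) 1, |x - s|⁻¹ = Real.log (|x| + 1) - Real.log (|x| - 1) := by
    rw [← integral_Ioc_eq_integral_Ioo, ← intervalIntegral.integral_of_le (by norm_num)]
    have hii : IntervalIntegrable (fun s : ℝ => |x - s|⁻¹) volume (-1) 1 :=
      ContinuousOn.intervalIntegrable (by rwa [uIcc_of_le (by norm_num)])
    rcases le_or_gt 0 x with h0 | h0
    · rw [abs_of_nonneg h0] at hx ⊢
      rw [intervalIntegral.integral_eq_sub_of_hasDerivAt (f := fun s => -Real.log (x - s)) _ hii]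
      · rw [sub_neg_eq_add x 1]; ring
      · intro s hs
        rw [uIcc_of_le (by norm_num)] at hs
        have h := (((hasDerivAt_id s).const_sub x).log (hne s hs)).neg
        refine h.congr_deriv ?_
        simp only [id]
        rw [abs_of_pos (by linarith [hs.2])]
        ring
    · rw [abs_of_neg h0] at hx ⊢
      rw [intervalIntegral.integral_eq_sub_of_hasDerivAt (f := fun s => Real.log (s - x)) _ hii]
      · ring_nf
      · intro s hs
        rw [uIcc_of_le (by norm_num)] at hs
        have h := (((hasDerivAt_id s).sub_const x).log (sub_ne_zero.2 (sub_ne_zero.1 (hne s hs)).symm))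
        refine h.congr_deriv ?_
        simp only [id]
        rw [abs_of_neg (by linarith [hs.1])]
        ring
  rw [cauchyExtension_re hm hB x hy, ← hval]
  have h : ‖∫ s in Ioo (-1 : ℝ) 1, φ s * ((x - s) / ((x - s) ^ 2 + y ^ 2))‖ ≤
      ∫ s in Ioo (-1 : ℝ) 1, π * β * |x - s|⁻¹ := by
    refine norm_integral_le_of_norm_le
      ((hc.integrableOn_Icc.mono_set Ioo_subset_Icc_self).const_mul _) ?_
    refine (ae_restrict_mem measurableSet_Ioo).mono fun s hs => ?_
    have hs' := abs_pos.2 (hne s (Ioo_subset_Icc_self hs))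
    rw [norm_mul, Real.norm_eq_abs, Real.norm_eq_abs]
    refine mul_le_mul (hB s) ?_ (abs_nonneg _) (by positivity)
    rw [abs_div, abs_of_pos (a := (x - s) ^ 2 + y ^ 2) (by positivity), div_le_iff₀ (by positivity),
      inv_mul_eq_div, le_div_iff₀ hs', ← sq, sq_abs]
    linarith [sq_nonneg y]
  rw [integral_const_mul, Real.norm_eq_abs] at h
  have h2 := (neg_le_abs _).trans h
  calc _ = 1 / π * -(∫ s in Ioo (-1 : ℝ) 1, φ s * ((x - s) / ((x - s) ^ 2 + y ^ 2))) := by ring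
    _ ≤ 1 / π * (π * β * _) := by gcongr
    _ = _ := by field_simp

/-- The analytic function `exp (q G) (1 - z²)^(-q/2)` on the upper half-plane, where `G` is the
analytic extension of `HT φ + i φ`. -/
noncomputable def weightedExp (φ : ℝ → ℝ) (q : ℝ) (z : ℂ) : ℂ :=
  Complex.exp (q * cauchyExtension φ z -
    ((q / 2 : ℝ) : ℂ) * (Complex.log (1 - z) + Complex.log (1 + z)))

theorem norm_weightedExp (φ : ℝ → ℝ) (q : ℝ) (z : ℂ) :
    ‖weightedExp φ q z‖ = Real.exp (q * (cauchyExtension φ z).re -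
      q / 2 * (Real.log ‖1 - z‖ + Real.log ‖1 + z‖)) := by
  rw [weightedExp, Complex.norm_exp, Complex.sub_re, Complex.re_ofReal_mul, Complex.re_ofReal_mul,
    Complex.add_re, Complex.log_re, Complex.log_re]

theorem differentiableAt_weightedExp {φ : ℝ → ℝ} (hm : AEStronglyMeasurable φ volume) {B : ℝ}
    (hB : ∀ s, |φ s| ≤ B) (q : ℝ) {z : ℂ} (hz : 0 < z.im) :
    DifferentiableAt ℂ (weightedExp φ q) z := by
  have h1 : 1 - z ∈ Complex.slitPlane := Or.inr (by simpa using hz.ne')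
  have h2 : 1 + z ∈ Complex.slitPlane := Or.inr (by simpa using hz.ne')
  have h3 := differentiableAt_cauchyExtension hm hB hz
  unfold weightedExp
  fun_prop (disch := assumption)

theorem arg_eq_arctan_of_re_pos {z : ℂ} (hz : 0 < z.re) : z.arg = Real.arctan (z.im / z.re) := by
  have h := abs_lt.1 (Complex.abs_arg_lt_pi_div_two_iff.2 (Or.inl hz))
  rw [← Complex.tan_arg, Real.arctan_tan h.1 h.2]

theorem cos_mul_norm_weightedExp_le_re {φ : ℝ → ℝ} (hm : AEStronglyMeasurable φ volume) {β q : ℝ}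
    (hβ : 0 ≤ β) (hβ2 : β ≤ 1 / 2) (hq : 0 < q) (hqβ : q * (1 / 2 + β) ≤ 1)
    (hB : ∀ s, |φ s| ≤ π * β) {x : ℝ} (hx : x ∈ Ioo (-1 : ℝ) 1) {y : ℝ} (hy : 0 < y) :
    Real.cos (q * (1 / 2 + β) * (π / 2)) * ‖weightedExp φ q (x + y * Complex.I)‖ ≤
      (weightedExp φ q (x + y * Complex.I)).re := by
  have hx1 : 0 < 1 + x := by linarith [hx.1]
  have hx2 : 0 < 1 - x := by linarith [hx.2]
  rw [mul_comm, weightedExp, Complex.exp_re, ← Complex.norm_exp]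
  refine mul_le_mul_of_nonneg_left ?_ (norm_nonneg _)
  rw [← Real.cos_abs (Complex.im _)]
  have hG := abs_cauchyExtension_im_le hm hB x hy
  have hA : 0 ≤ Real.arctan ((1 + x) / y) := Real.arctan_nonneg.2 (by positivity)
  have hA' := Real.arctan_lt_pi_div_two ((1 + x) / y)
  have hC : 0 ≤ Real.arctan ((1 - x) / y) := Real.arctan_nonneg.2 (by positivity)
  have hC' := Real.arctan_lt_pi_div_two ((1 - x) / y)
  have e1 : (1 + ((x : ℂ) + y * Complex.I)).arg = π / 2 - Real.arctan ((1 + x) / y) := by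
    rw [arg_eq_arctan_of_re_pos (by simpa using hx1), ← Real.arctan_inv_of_pos (by positivity)]
    simp
  have e2 : (1 - ((x : ℂ) + y * Complex.I)).arg = -(π / 2 - Real.arctan ((1 - x) / y)) := by
    rw [arg_eq_arctan_of_re_pos (by simpa using hx2), ← Real.arctan_inv_of_pos (by positivity),
      ← Real.arctan_neg]
    simp [neg_div]
  rw [Complex.sub_im, Complex.im_ofReal_mul, Complex.im_ofReal_mul, Complex.add_im, Complex.log_im,
    Complex.log_im, e1, e2]
  set A := Real.arctan ((1 + x) / y)
  set D := Real.arctan ((1 - x) / y)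
  set g := (cauchyExtension φ (x + y * Complex.I)).im
  have hg := abs_le.1 hG
  have hpi := Real.pi_pos
  refine Real.cos_le_cos_of_nonneg_of_le_pi (abs_nonneg _) (by nlinarith) ?_
  have hkey : |g - 1 / 2 * (D - A)| ≤ (1 / 2 + β) * (π / 2) := by
    have h1 : β * A ≤ β * (π / 2) := mul_le_mul_of_nonneg_left hA'.le hβ
    have h2 : β * D ≤ β * (π / 2) := mul_le_mul_of_nonneg_left hC'.le hβ
    have h3 : β * A ≤ 1 / 2 * A := mul_le_mul_of_nonneg_right hβ2 hA
    have h4 : β * D ≤ 1 / 2 * D := mul_le_mul_of_nonneg_right hβ2 hC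
    refine abs_le.2 ⟨?_, ?_⟩ <;> linarith [hg.1, hg.2]
  calc |q * g - q / 2 * (-(π / 2 - D) + (π / 2 - A))| = q * |g - 1 / 2 * (D - A)| := by
        rw [← abs_of_pos hq, ← abs_mul, abs_of_pos hq]
        ring_nf
    _ ≤ q * ((1 / 2 + β) * (π / 2)) := by gcongr
    _ = _ := by ring

theorem norm_weightedExp_le_of_one_le {φ : ℝ → ℝ} {β q : ℝ} (hq : 0 < q)
    (hB : ∀ s, |φ s| ≤ π * β) {z : ℂ} (hz : ∀ s ∈ Icc (-1 : ℝ) 1, 1 ≤ ‖z - s‖) :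
    ‖weightedExp φ q z‖ ≤ Real.exp (q * (2 * β)) := by
  rw [norm_weightedExp, Real.exp_le_exp]
  have h1 := hz 1 (by norm_num)
  have h2 := hz (-1) (by norm_num)
  rw [norm_sub_rev] at h1
  push_cast at h1 h2
  rw [sub_neg_eq_add, add_comm] at h2
  have h3 := (Complex.re_le_norm _).trans
    (norm_cauchyExtension_le hB fun s hs => hz s (Ioo_subset_Icc_self hs))
  have h4 := mul_le_mul_of_nonneg_left h3 hq.le
  have h5 : 0 ≤ q / 2 * (Real.log ‖1 - z‖ + Real.log ‖1 + z‖) :=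
    mul_nonneg (by positivity) (add_nonneg (Real.log_nonneg h1) (Real.log_nonneg h2))
  linarith

theorem norm_weightedExp_le_of_one_lt {φ : ℝ → ℝ} (hm : AEStronglyMeasurable φ volume) {β q : ℝ}
    (hβ : 0 ≤ β) (hq : 0 < q) (hB : ∀ s, |φ s| ≤ π * β) {x : ℝ} (hx : 1 < |x|) (hx2 : |x| ≤ 2)
    {y : ℝ} (hy : 0 < y) :
    ‖weightedExp φ q (x + y * Complex.I)‖ ≤
      Real.exp (q * (β * Real.log 3)) * (|x| - 1) ^ (-(q * (1 / 2 + β))) := by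
  have hpos : 0 < |x| - 1 := by linarith
  rw [norm_weightedExp, Real.rpow_def_of_pos hpos, ← Real.exp_add, Real.exp_le_exp]
  have h1 := mul_le_mul_of_nonneg_left (cauchyExtension_re_le hm hβ hB hx hy) hq.le
  have h2 : Real.log (|x| + 1) ≤ Real.log 3 := Real.log_le_log (by linarith) (by linarith)
  have h3 := mul_le_mul_of_nonneg_left (mul_le_mul_of_nonneg_left h2 hβ) hq.le
  have hre1 : |1 - x| ≤ ‖1 - ((x : ℂ) + y * Complex.I)‖ := by
    simpa using Complex.abs_re_le_norm (1 - ((x : ℂ) + y * Complex.I))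
  have hre2 : |1 + x| ≤ ‖1 + ((x : ℂ) + y * Complex.I)‖ := by
    simpa using Complex.abs_re_le_norm (1 + ((x : ℂ) + y * Complex.I))
  have hlog : Real.log (|x| - 1) ≤ Real.log ‖1 - ((x : ℂ) + y * Complex.I)‖ +
      Real.log ‖1 + ((x : ℂ) + y * Complex.I)‖ := by
    rcases le_or_gt 0 x with h0 | h0
    · rw [abs_of_nonneg h0] at hx hpos ⊢
      rw [abs_of_neg (by linarith)] at hre1
      rw [abs_of_pos (by linarith)] at hre2
      have := Real.log_le_log hpos (by linarith : x - 1 ≤ _)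
      have := Real.log_nonneg (by linarith : 1 ≤ ‖1 + ((x : ℂ) + y * Complex.I)‖)
      have := Real.log_le_log hpos (by linarith : x - 1 ≤ ‖1 - ((x : ℂ) + y * Complex.I)‖)
      linarith
    · rw [abs_of_neg h0] at hx hpos ⊢
      rw [abs_of_pos (by linarith)] at hre1
      rw [abs_of_neg (by linarith)] at hre2
      have := Real.log_nonneg (by linarith : 1 ≤ ‖1 - ((x : ℂ) + y * Complex.I)‖)
      have := Real.log_le_log hpos (by linarith : -x - 1 ≤ ‖1 + ((x : ℂ) + y * Complex.I)‖)
      linarith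
  have h4 := mul_le_mul_of_nonneg_left hlog (by positivity : 0 ≤ q / 2)
  linarith

theorem continuous_weightedExp_horizontal {φ : ℝ → ℝ} (hm : AEStronglyMeasurable φ volume) {B : ℝ}
    (hB : ∀ s, |φ s| ≤ B) (q : ℝ) {y : ℝ} (hy : 0 < y) :
    Continuous fun x : ℝ => weightedExp φ q (x + y * Complex.I) := by
  refine continuous_iff_continuousAt.2 fun x => ?_
  have hz : 0 < ((x : ℂ) + y * Complex.I).im := by simpa using hy
  have h := (differentiableAt_weightedExp hm hB q hz).continuousAt
  exact ContinuousAt.comp (f := fun x : ℝ => (x : ℂ) + y * Complex.I) h (by fun_prop)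

theorem norm_integral_weightedExp_le {φ : ℝ → ℝ} (hm : AEStronglyMeasurable φ volume) {β q : ℝ}
    (hq : 0 < q) (hB : ∀ s, |φ s| ≤ π * β) {y : ℝ} (hy : 0 < y) (hy1 : y ≤ 1) :
    ‖∫ x in (-2 : ℝ)..2, weightedExp φ q (x + y * Complex.I)‖ ≤ 8 * Real.exp (q * (2 * β)) := by
  have hC := Complex.integral_boundary_rect_eq_zero_of_differentiableOn (weightedExp φ q)
    (-2 + y * Complex.I) (2 + 2 * Complex.I) (fun z hz => by
      have h2 : z.im ∈ uIcc y 2 := by simpa using hz.2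
      rw [uIcc_of_le (by linarith)] at h2
      exact (differentiableAt_weightedExp hm hB q (hy.trans_le h2.1)).differentiableWithinAt)
  simp only [Complex.add_re, Complex.neg_re, Complex.re_ofNat, Complex.mul_re, Complex.ofReal_re,
    Complex.I_re, mul_zero, Complex.ofReal_im, Complex.I_im, mul_one, sub_self, add_zero,
    Complex.add_im, Complex.neg_im, Complex.im_ofNat, neg_zero, Complex.mul_im, zero_add,
    smul_eq_mul] at hC
  set E := Real.exp (q * (2 * β))
  have hE : 0 < E := Real.exp_pos _
  have b1 : ‖∫ x in (-2 : ℝ)..2, weightedExp φ q (x + (2 : ℝ) * Complex.I)‖ ≤ E * |2 - (-2)| := by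
    refine intervalIntegral.norm_integral_le_of_norm_le_const fun x _ =>
      norm_weightedExp_le_of_one_le hq hB fun s _ => ?_
    have := Complex.abs_im_le_norm ((x : ℂ) + (2 : ℝ) * Complex.I - s)
    simp only [Complex.sub_im, Complex.add_im, Complex.ofReal_im, Complex.im_ofReal_mul,
      Complex.I_im] at this
    norm_num at this ⊢
    linarith
  have hside : ∀ a : ℝ, |a| = 2 →
      ‖∫ v in y..2, weightedExp φ q (a + v * Complex.I)‖ ≤ E * |2 - y| := by
    intro a ha
    refine intervalIntegral.norm_integral_le_of_norm_le_const fun v _ =>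
      norm_weightedExp_le_of_one_le hq hB fun s hs => ?_
    have := Complex.abs_re_le_norm ((a : ℂ) + v * Complex.I - s)
    simp only [Complex.sub_re, Complex.add_re, Complex.ofReal_re, Complex.re_ofReal_mul,
      Complex.I_re, mul_zero, add_zero] at this
    have h1 := abs_sub_abs_le_abs_sub a s
    have h2 := abs_le.2 hs
    linarith
  have b2 := hside 2 (by norm_num)
  have b3 := hside (-2) (by norm_num)
  have e2 : |2 - y| ≤ 2 := abs_le.2 ⟨by linarith, by linarith⟩
  have e2' := mul_le_mul_of_nonneg_left e2 hE.le
  have e1 : |(2 : ℝ) - (-2)| = 4 := by norm_num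
  rw [e1] at b1
  have heq : ∫ x in (-2 : ℝ)..2, weightedExp φ q (x + y * Complex.I) =
      (∫ x in (-2 : ℝ)..2, weightedExp φ q (x + (2 : ℝ) * Complex.I)) -
      Complex.I * (∫ v in y..2, weightedExp φ q ((2 : ℝ) + v * Complex.I)) +
      Complex.I * (∫ v in y..2, weightedExp φ q ((-2 : ℝ) + v * Complex.I)) := by
    push_cast at hC ⊢
    linear_combination hC
  rw [heq]
  refine (norm_add_le _ _).trans ?_
  have := norm_sub_le (∫ x in (-2 : ℝ)..2, weightedExp φ q (x + (2 : ℝ) * Complex.I))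
    (Complex.I * (∫ v in y..2, weightedExp φ q ((2 : ℝ) + v * Complex.I)))
  rw [norm_mul, Complex.norm_I, one_mul] at this ⊢
  linarith

theorem exists_integral_norm_weightedExp_le {β q : ℝ} (hβ : 0 ≤ β) (hβ2 : β ≤ 1 / 2) (hq : 0 < q)
    (hqβ : q * (1 / 2 + β) < 1) : ∃ C : ℝ, ∀ φ : ℝ → ℝ, AEStronglyMeasurable φ volume →
      (∀ s, |φ s| ≤ π * β) → ∀ y : ℝ, 0 < y → y ≤ 1 →
        ∫ x in (-1 : ℝ)..1, ‖weightedExp φ q (x + y * Complex.I)‖ ≤ C := by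
  set r := q * (1 / 2 + β) with hr
  set E := Real.exp (q * (β * Real.log 3))
  set c := Real.cos (r * (π / 2)) with hc
  have hr0 : 0 < r := by positivity
  have hcpos : 0 < c := Real.cos_pos_of_mem_Ioo
    ⟨by nlinarith [Real.pi_pos], by nlinarith [Real.pi_pos]⟩
  have hi0 : IntervalIntegrable (fun x : ℝ => x ^ (-r)) volume 0 1 :=
    intervalIntegral.intervalIntegrable_rpow' (by linarith)
  have hi1 : IntervalIntegrable (fun x : ℝ => E * (x - 1) ^ (-r)) volume 1 2 := by
    have h := (hi0.comp_sub_right 1).const_mul E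
    norm_num at h
    exact h
  have hi2 : IntervalIntegrable (fun x : ℝ => E * (-x - 1) ^ (-r)) volume (-2) (-1) := by
    have h := ((hi0.comp_sub_left (-1)).symm).const_mul E
    norm_num at h
    simpa only [neg_sub_left, neg_add', add_comm, sub_eq_add_neg] using h
  refine ⟨c⁻¹ * (8 * Real.exp (q * (2 * β)) + (∫ x in (-2 : ℝ)..(-1), E * (-x - 1) ^ (-r)) +
    ∫ x in (1 : ℝ)..2, E * (x - 1) ^ (-r)), fun φ hm hB y hy hy1 => ?_⟩
  have hcont := continuous_weightedExp_horizontal hm hB q hy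
  have hii : ∀ a b : ℝ, IntervalIntegrable (fun x : ℝ => weightedExp φ q (x + y * Complex.I))
    volume a b := fun a b => hcont.intervalIntegrable a b
  have b1 : ‖∫ x in (-2 : ℝ)..(-1), weightedExp φ q (x + y * Complex.I)‖ ≤
      ∫ x in (-2 : ℝ)..(-1), E * (-x - 1) ^ (-r) := by
    refine intervalIntegral.norm_integral_le_of_norm_le (by norm_num) ?_ hi2
    have hne : ∀ᵐ x : ℝ, x ≠ -1 := by simp [ae_iff, measure_singleton]
    filter_upwards [hne] with x hx1 hx
    have hx' : x < -1 := lt_of_le_of_ne hx.2 hx1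
    have h := norm_weightedExp_le_of_one_lt hm hβ hq hB (x := x)
      (by rw [abs_of_neg (by linarith)]; linarith)
      (by rw [abs_of_neg (by linarith)]; linarith [hx.1]) hy
    rwa [abs_of_neg (by linarith : x < 0)] at h
  have b2 : ‖∫ x in (1 : ℝ)..2, weightedExp φ q (x + y * Complex.I)‖ ≤
      ∫ x in (1 : ℝ)..2, E * (x - 1) ^ (-r) := by
    refine intervalIntegral.norm_integral_le_of_norm_le (by norm_num)
      (ae_of_all _ fun x hx => ?_) hi1
    have h := norm_weightedExp_le_of_one_lt hm hβ hq hB (x := x)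
      (by rw [abs_of_pos (by linarith [hx.1])]; exact hx.1)
      (by rw [abs_of_pos (by linarith [hx.1])]; exact hx.2) hy
    rwa [abs_of_pos (by linarith [hx.1] : 0 < x)] at h
  have b3 := norm_integral_weightedExp_le hm hq hB hy hy1
  have hsum : ∫ x in (-1 : ℝ)..1, weightedExp φ q (x + y * Complex.I) =
      (∫ x in (-2 : ℝ)..2, weightedExp φ q (x + y * Complex.I)) -
      (∫ x in (-2 : ℝ)..(-1), weightedExp φ q (x + y * Complex.I)) -
      ∫ x in (1 : ℝ)..2, weightedExp φ q (x + y * Complex.I) := by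
    rw [← intervalIntegral.integral_add_adjacent_intervals (hii (-2) (-1)) (hii (-1) 2),
      ← intervalIntegral.integral_add_adjacent_intervals (hii (-1) 1) (hii 1 2)]
    ring
  have b4 : ‖∫ x in (-1 : ℝ)..1, weightedExp φ q (x + y * Complex.I)‖ ≤
      8 * Real.exp (q * (2 * β)) + (∫ x in (-2 : ℝ)..(-1), E * (-x - 1) ^ (-r)) +
      ∫ x in (1 : ℝ)..2, E * (x - 1) ^ (-r) := by
    rw [hsum]
    exact norm_sub_le_of_le (norm_sub_le_of_le b3 b1) b2
  have hre : (∫ x in (-1 : ℝ)..1, weightedExp φ q (x + y * Complex.I)).re =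
      ∫ x in (-1 : ℝ)..1, (weightedExp φ q (x + y * Complex.I)).re := by
    exact (Complex.reCLM.intervalIntegral_comp_comm (hii (-1) 1)).symm
  have b5 : c * ∫ x in (-1 : ℝ)..1, ‖weightedExp φ q (x + y * Complex.I)‖ ≤
      (∫ x in (-1 : ℝ)..1, weightedExp φ q (x + y * Complex.I)).re := by
    rw [hre, ← intervalIntegral.integral_const_mul]
    refine intervalIntegral.integral_mono_on_of_le_Ioo (by norm_num)
      ((hcont.norm.const_mul c).intervalIntegrable _ _)
      ((Complex.continuous_re.comp hcont).intervalIntegrable _ _) fun x hx => ?_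
    exact cos_mul_norm_weightedExp_le_re hm hβ hβ2 hq hqβ.le hB hx hy
  rw [inv_mul_eq_div, le_div_iff₀ hcpos, mul_comm]
  exact b5.trans ((Complex.re_le_norm _).trans b4)

/-- Lipschitz control of a function at a single point, on a neighbourhood of that point. -/
def LipschitzNear (φ : ℝ → ℝ) (x : ℝ) : Prop :=
  ∃ K δ : ℝ, 0 ≤ K ∧ 0 < δ ∧ ∀ s, |s - x| ≤ δ → |φ s - φ x| ≤ K * |s - x|

theorem LipschitzNear.continuousAt {φ : ℝ → ℝ} {x : ℝ} (h : LipschitzNear φ x) :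
    ContinuousAt φ x := by
  obtain ⟨K, δ, -, hδ, hL⟩ := h
  refine tendsto_iff_norm_sub_tendsto_zero.2 (squeeze_zero' (g := fun s => K * |s - x|)
    (Eventually.of_forall fun _ => norm_nonneg _) ?_ ?_)
  · filter_upwards [Metric.closedBall_mem_nhds x hδ] with s hs
    exact hL s hs
  · have : ContinuousAt (fun s => K * |s - x|) x := by fun_prop
    simpa using this.tendsto

theorem LipschitzNear.arctan {φ : ℝ → ℝ} {x : ℝ} (h : LipschitzNear φ x) :
    LipschitzNear (fun s => Real.arctan (φ s)) x := by
  obtain ⟨K, δ, hK, hδ, hL⟩ := h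
  refine ⟨K, δ, hK, hδ, fun s hs => le_trans ?_ (hL s hs)⟩
  have hlip : LipschitzWith 1 Real.arctan :=
    lipschitzWith_of_nnnorm_deriv_le Real.differentiable_arctan fun z => by
      rw [← NNReal.coe_le_coe, coe_nnnorm, Real.norm_eq_abs, Real.deriv_arctan, NNReal.coe_one,
        abs_of_pos (by positivity), div_le_one (by positivity)]
      linarith [sq_nonneg z]
  simpa [Real.dist_eq] using hlip.dist_le_mul (φ s) (φ x)

theorem PiecewiseLipschitzOn.exists_finite_lipschitzNear {f : ℝ → ℝ}
    (hf : PiecewiseLipschitzOn f) :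
    ∃ D : Set ℝ, D.Finite ∧ ∀ x ∈ Ioo (-1 : ℝ) 1, x ∉ D → LipschitzNear f x := by
  obtain ⟨m, y, -, hy0, hym, -, hL⟩ := hf
  refine ⟨y '' Iic m, (finite_Iic m).image y, fun x hx hxD => ?_⟩
  classical
  have hex : ∃ j, x < y j := ⟨m, by rw [hym]; exact hx.2⟩
  have hjm : Nat.find hex ≤ m := Nat.find_min' hex (by rw [hym]; exact hx.2)
  have hjx := Nat.find_spec hex
  obtain ⟨i, hi⟩ : ∃ i, Nat.find hex = i + 1 := by
    refine Nat.exists_eq_succ_of_ne_zero fun h => ?_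
    rw [h, hy0] at hjx
    exact absurd hx.1 (not_lt.2 hjx.le)
  have hix : y i ≤ x := not_lt.1 (Nat.find_min hex (by omega))
  rw [hi] at hjx hjm
  have hix' : y i < x := lt_of_le_of_ne hix fun h => hxD ⟨i, by simp; omega, h⟩
  obtain ⟨K, hK⟩ := hL i (by omega)
  obtain ⟨δ, hδ, hsub⟩ := Metric.nhds_basis_closedBall.mem_iff.1 (Ioo_mem_nhds hix' hjx)
  refine ⟨K, δ, K.2, hδ, fun s hs => ?_⟩
  simpa [Real.dist_eq] using hK.dist_le_mul s (hsub hs) x ⟨hix', hjx⟩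

theorem aestronglyMeasurable_of_lipschitzNear {φ : ℝ → ℝ} (h0 : ∀ s ∉ Ioo (-1 : ℝ) 1, φ s = 0)
    {D : Set ℝ} (hD : D.Finite) (hL : ∀ x ∈ Ioo (-1 : ℝ) 1, x ∉ D → LipschitzNear φ x) :
    AEStronglyMeasurable φ volume := by
  have h1 : AEStronglyMeasurable φ (volume.restrict (Ioo (-1 : ℝ) 1 \ D)) :=
    ContinuousOn.aestronglyMeasurable
      (fun x hx => (hL x hx.1 hx.2).continuousAt.continuousWithinAt)
      (measurableSet_Ioo.diff hD.measurableSet)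
  have h2 : AEStronglyMeasurable φ (volume.restrict (Ioo (-1 : ℝ) 1)ᶜ) :=
    (aestronglyMeasurable_const (b := (0 : ℝ))).congr
      ((ae_restrict_mem measurableSet_Ioo.compl).mono fun s hs => (h0 s hs).symm)
  have h3 := aestronglyMeasurable_union_iff.2 ⟨h1, h2⟩
  rwa [Measure.restrict_eq_self_of_ae_mem] at h3
  filter_upwards [hD.countable.ae_notMem volume] with s hs
  by_cases hs' : s ∈ Ioo (-1 : ℝ) 1
  · exact Or.inl ⟨hs', hs⟩
  · exact Or.inr hs'

theorem tendsto_norm_weightedExp {φ : ℝ → ℝ} (hm : AEStronglyMeasurable φ volume) {B : ℝ}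
    (hB : ∀ s, |φ s| ≤ B) (h0 : ∀ s ∉ Ioo (-1 : ℝ) 1, φ s = 0) (q : ℝ) {x : ℝ}
    (hx : x ∈ Ioo (-1 : ℝ) 1) (hL : LipschitzNear φ x) :
    Tendsto (fun y : ℝ => ‖weightedExp φ q (x + y * Complex.I)‖) (𝓝[>] 0)
      (𝓝 (Real.exp (q * HT φ x - q / 2 * (Real.log (1 - x) + Real.log (1 + x))))) := by
  obtain ⟨K, δ, hK, hδ, hL⟩ := hL
  have hHT : HT φ x = _ := ((tendsto_truncated_kernel hm hB h0 hK hδ hL).const_mul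
    (-(1 / π))).limUnder_eq
  have hG : Tendsto (fun y : ℝ => (cauchyExtension φ (x + y * Complex.I)).re) (𝓝[>] 0)
      (𝓝 (HT φ x)) := by
    rw [hHT]
    refine ((tendsto_conjugate_poisson_kernel hm hB h0 hK hδ hL).const_mul (-(1 / π))).congr' ?_
    filter_upwards [self_mem_nhdsWithin] with y hy
    rw [cauchyExtension_re hm hB x hy, setIntegral_eq_integral_of_forall_compl_eq_zero]
    intro s hs
    rw [h0 s hs, zero_mul]
  have hx1 : 0 < 1 - x := by linarith [hx.2]
  have hx2 : 0 < 1 + x := by linarith [hx.1]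
  have hl1 : Tendsto (fun y : ℝ => Real.log ‖1 - ((x : ℂ) + y * Complex.I)‖) (𝓝[>] 0)
      (𝓝 (Real.log (1 - x))) := by
    have e : ‖1 - ((x : ℂ) + (0 : ℝ) * Complex.I)‖ = 1 - x := by
      rw [Complex.ofReal_zero, zero_mul, add_zero, ← Complex.ofReal_one, ← Complex.ofReal_sub,
        Complex.norm_real, Real.norm_eq_abs, abs_of_pos hx1]
    have hc : ContinuousAt (fun y : ℝ => Real.log ‖1 - ((x : ℂ) + y * Complex.I)‖) 0 :=
      ContinuousAt.log (by fun_prop) (by rw [e]; exact hx1.ne')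
    have h := hc.tendsto
    rw [e] at h
    exact h.mono_left nhdsWithin_le_nhds
  have hl2 : Tendsto (fun y : ℝ => Real.log ‖1 + ((x : ℂ) + y * Complex.I)‖) (𝓝[>] 0)
      (𝓝 (Real.log (1 + x))) := by
    have e : ‖1 + ((x : ℂ) + (0 : ℝ) * Complex.I)‖ = 1 + x := by
      rw [Complex.ofReal_zero, zero_mul, add_zero, ← Complex.ofReal_one, ← Complex.ofReal_add,
        Complex.norm_real, Real.norm_eq_abs, abs_of_pos hx2]
    have hc : ContinuousAt (fun y : ℝ => Real.log ‖1 + ((x : ℂ) + y * Complex.I)‖) 0 :=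
      ContinuousAt.log (by fun_prop) (by rw [e]; exact hx2.ne')
    have h := hc.tendsto
    rw [e] at h
    exact h.mono_left nhdsWithin_le_nhds
  simp only [norm_weightedExp]
  exact (((hG.const_mul q).sub ((hl1.add hl2).const_mul (q / 2))).rexp)

theorem lintegral_exp_HT_le {φ : ℝ → ℝ} (hm : AEStronglyMeasurable φ volume) {B : ℝ}
    (hB : ∀ s, |φ s| ≤ B) (h0 : ∀ s ∉ Ioo (-1 : ℝ) 1, φ s = 0) {D : Set ℝ} (hD : D.Finite)
    (hL : ∀ x ∈ Ioo (-1 : ℝ) 1, x ∉ D → LipschitzNear φ x) {q C : ℝ}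
    (hC : ∀ y : ℝ, 0 < y → y ≤ 1 →
      ∫ x in (-1 : ℝ)..1, ‖weightedExp φ q (x + y * Complex.I)‖ ≤ C) :
    ∫⁻ x in Ioo (-1 : ℝ) 1, ENNReal.ofReal
      (Real.exp (q * HT φ x - q / 2 * (Real.log (1 - x) + Real.log (1 + x)))) ≤
        ENNReal.ofReal C := by
  set u : ℕ → ℝ := fun n => 1 / ((n : ℝ) + 1)
  have hu0 : ∀ n, 0 < u n := fun n => Nat.one_div_pos_of_nat
  have hu1 : ∀ n, u n ≤ 1 := fun n =>
    (div_le_one (by positivity)).2 (by linarith [n.cast_nonneg (α := ℝ)])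
  have hu : Tendsto u atTop (𝓝[>] 0) :=
    tendsto_nhdsWithin_iff.2 ⟨tendsto_one_div_add_atTop_nhds_zero_nat, Eventually.of_forall hu0⟩
  have hcont : ∀ n, Continuous fun x : ℝ => ‖weightedExp φ q (x + u n * Complex.I)‖ := fun n =>
    (continuous_weightedExp_horizontal hm hB q (hu0 n)).norm
  calc _ = ∫⁻ x in Ioo (-1 : ℝ) 1, liminf (fun n =>
        ENNReal.ofReal ‖weightedExp φ q (x + u n * Complex.I)‖) atTop := by
        refine lintegral_congr_ae ?_
        filter_upwards [ae_restrict_mem measurableSet_Ioo,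
          ae_restrict_of_ae (hD.countable.ae_notMem volume)] with x hx hxD
        exact (((ENNReal.continuous_ofReal.tendsto _).comp
          ((tendsto_norm_weightedExp hm hB h0 q hx (hL x hx hxD)).comp hu)).liminf_eq).symm
    _ ≤ liminf (fun n => ∫⁻ x in Ioo (-1 : ℝ) 1,
          ENNReal.ofReal ‖weightedExp φ q (x + u n * Complex.I)‖) atTop :=
        lintegral_liminf_le fun n => (hcont n).measurable.ennreal_ofReal
    _ ≤ ENNReal.ofReal C := by
        refine liminf_le_of_frequently_le' (Frequently.of_forall fun n => ?_)
        rw [← ofReal_integral_eq_lintegral_ofReal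
          ((hcont n).continuousOn.integrableOn_Icc.mono_set Ioo_subset_Icc_self)
          (ae_of_all _ fun _ => norm_nonneg _), ← integral_Ioc_eq_integral_Ioo,
          ← intervalIntegral.integral_of_le (by norm_num)]
        exact ENNReal.ofReal_le_ofReal (hC (u n) (hu0 n) (hu1 n))

theorem div_rpow_le_exp {q a x v : ℝ} (hq : 0 ≤ q) (hx : x ∈ Ioo (-1 : ℝ) 1) :
    (Real.exp a / (π * √(1 - x ^ 2) * √(1 + v ^ 2))) ^ q ≤
      Real.exp (q * a - q / 2 * (Real.log (1 - x) + Real.log (1 + x))) := by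
  have hx1 : 0 < 1 - x := by linarith [hx.2]
  have hx2 : 0 < 1 + x := by linarith [hx.1]
  have hw : 0 < √(1 - x ^ 2) := Real.sqrt_pos.2 (by nlinarith)
  have hv : 1 ≤ √(1 + v ^ 2) := Real.one_le_sqrt.2 (by linarith [sq_nonneg v])
  have hden : √(1 - x ^ 2) ≤ π * √(1 - x ^ 2) * √(1 + v ^ 2) := by
    have h1 : √(1 - x ^ 2) ≤ π * √(1 - x ^ 2) :=
      le_mul_of_one_le_left hw.le (by linarith [Real.pi_gt_three])
    exact h1.trans (le_mul_of_one_le_right (hw.le.trans h1) hv)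
  have hle : Real.exp a / (π * √(1 - x ^ 2) * √(1 + v ^ 2)) ≤ Real.exp a / √(1 - x ^ 2) := by
    gcongr
  refine (Real.rpow_le_rpow (by positivity) hle hq).trans (le_of_eq ?_)
  rw [Real.rpow_def_of_pos (by positivity), Real.log_div (Real.exp_ne_zero _) hw.ne',
    Real.log_exp, Real.log_sqrt (by nlinarith), ← Real.log_mul hx1.ne' hx2.ne']
  ring_nf

/-- The key `L^q` estimate: if `(f_n)` is a uniformly bounded
sequence of piecewise Lipschitz friction coefficients (`|f_n| ≤ M` on `(-1,1)`)
and `t_n = e^{τ_n}/(π√(1-x²)√(1+f_n²))`, then for each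
`q ∈ (1, (1/2+β)⁻¹)`, with `β = (1/π)·arctan M`, the sequence `(t_n)` is bounded
in `L^q(-1,1)`. -/
theorem stmt8 (f : ℕ → ℝ → ℝ)
    (hf_pl : ∀ n, PiecewiseLipschitzOn (f n))
    (hf_zero : ∀ n x, x ∉ Set.Ioo (-1:ℝ) 1 → f n x = 0)
    (M : ℝ) (hM : ∀ n, ∀ x ∈ Set.Ioo (-1:ℝ) 1, |f n x| ≤ M)
    (β : ℝ) (hβ : β = (1 / Real.pi) * Real.arctan M)
    (τ : ℕ → ℝ → ℝ) (hτ : ∀ n, τ n = HT (fun s => Real.arctan (f n s)))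
    (t : ℕ → ℝ → ℝ)
    (ht : ∀ n, ∀ x ∈ Set.Ioo (-1:ℝ) 1, t n x =
      Real.exp (τ n x) /
        (Real.pi * Real.sqrt (1 - x ^ 2) * Real.sqrt (1 + f n x ^ 2))) :
    ∀ q : ℝ, 1 < q → q < (1/2 + β)⁻¹ →
      ∃ C : ℝ, ∀ n, (∫ x in Set.Ioo (-1:ℝ) 1, t n x ^ q) ≤ C := by
  intro q hq1 hq2
  have hM0 : 0 ≤ M := (abs_nonneg _).trans (hM 0 0 (by norm_num))
  have hπ : Real.arctan M = π * β := by rw [hβ]; field_simp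
  have hβ0 : 0 ≤ β := by rw [hβ]; exact mul_nonneg (by positivity) (Real.arctan_nonneg.2 hM0)
  have hβ2 : β ≤ 1 / 2 := by
    have := Real.arctan_lt_pi_div_two M
    rw [hπ] at this
    nlinarith [Real.pi_pos]
  have hq0 : 0 < q := by linarith
  have hqβ : q * (1 / 2 + β) < 1 := by
    have hb : 0 < 1 / 2 + β := by positivity
    rwa [← one_div, lt_div_iff₀ hb] at hq2
  obtain ⟨C, hC⟩ := exists_integral_norm_weightedExp_le hβ0 hβ2 hq0 hqβ
  refine ⟨max C 0, fun n => ?_⟩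
  by_cases hint : Integrable (fun x => t n x ^ q) (volume.restrict (Ioo (-1 : ℝ) 1))
  swap
  · rw [integral_undef hint]
    exact le_max_right _ _
  obtain ⟨D, hD, hLf⟩ := (hf_pl n).exists_finite_lipschitzNear
  have h0 : ∀ s ∉ Ioo (-1 : ℝ) 1, Real.arctan (f n s) = 0 := fun s hs => by
    rw [hf_zero n s hs, Real.arctan_zero]
  have hL : ∀ x ∈ Ioo (-1 : ℝ) 1, x ∉ D → LipschitzNear (fun s => Real.arctan (f n s)) x :=
    fun x hx hxD => (hLf x hx hxD).arctan
  have hB : ∀ s, |Real.arctan (f n s)| ≤ π * β := by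
    intro s
    by_cases hs : s ∈ Ioo (-1 : ℝ) 1
    · have h := abs_le.1 (hM n s hs)
      rw [← hπ, abs_le, ← Real.arctan_neg]
      exact ⟨Real.arctan_mono h.1, Real.arctan_mono h.2⟩
    · rw [h0 s hs, abs_zero]
      positivity
  have hm := aestronglyMeasurable_of_lipschitzNear h0 hD hL
  have hpos : ∀ x ∈ Ioo (-1 : ℝ) 1, 0 ≤ t n x ^ q := fun x hx => by
    rw [ht n x hx]
    positivity
  rw [← ENNReal.ofReal_le_ofReal_iff (le_max_right _ _), ofReal_integral_eq_lintegral_ofReal hint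
    ((ae_restrict_mem measurableSet_Ioo).mono hpos)]
  refine (lintegral_mono_ae ((ae_restrict_mem measurableSet_Ioo).mono fun x hx => ?_)).trans
    ((lintegral_exp_HT_le hm hB h0 hD hL (hC _ hm hB)).trans
      (ENNReal.ofReal_le_ofReal (le_max_left _ _)))
  rw [ht n x hx, hτ n]
  exact ENNReal.ofReal_le_ofReal (div_rpow_le_exp hq0.le hx)
end

section
/- Let f̄ : ℝ → ℝ be a Lipschitz-continuous function with compact support, and define, for z ∈ ℂ with Im z > 0, φ(z) := (1/π)·∫_ℝ arctan f̄(s)/(s − z) ds. Then: (a) φ is holomorphic on the open upper half-plane Π⁺ := {z : Im z > 0}; (b) for a.e. x ∈ ℝ, lim_{y→0⁺} φ(x+iy) = τ̄(x) + i·arctan f̄(x), where τ̄ := 𝓗(arctan∘f̄); (c) Re e^{φ(z)} > 0 for all z ∈ Π⁺, and inf_ℝ f̄ ≤ Im e^{φ(z)} / Re e^{φ(z)} ≤ sup_ℝ f̄ for all z ∈ Π⁺; (d) there exist constants 0 < C₁ ≤ C₂ such that C₁ ≤ Re e^{φ(z)} ≤ C₂ for all z ∈ Π⁺. -/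
open MeasureTheory Filter Set Complex
open scoped Real Topology ENNReal

section CauchyTransform

variable {g : ℝ → ℝ}

theorem ofReal_sub_ne_zero_of_im_pos {z : ℂ} (hz : 0 < z.im) (s : ℝ) : (s : ℂ) - z ≠ 0 := by
  intro h
  have h' := congrArg Complex.im h
  simp at h'
  exact hz.ne' h'

theorem continuous_cauchyKernel (hg : Continuous g) {z : ℂ} (hz : 0 < z.im) :
    Continuous fun s : ℝ => (g s : ℂ) / ((s : ℂ) - z) :=
  (continuous_ofReal.comp hg).div (continuous_ofReal.sub continuous_const)
    (ofReal_sub_ne_zero_of_im_pos hz)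

theorem integrable_cauchyKernel (hg : Continuous g) (hs : HasCompactSupport g) {z : ℂ}
    (hz : 0 < z.im) : Integrable fun s : ℝ => (g s : ℂ) / ((s : ℂ) - z) := by
  refine (continuous_cauchyKernel hg hz).integrable_of_hasCompactSupport
    (hs.mono fun s h => ?_)
  contrapose! h
  simp only [Function.mem_support, not_not] at h ⊢
  simp [h]

theorem differentiableOn_integral_cauchyKernel (hg : Continuous g) (hs : HasCompactSupport g) :
    DifferentiableOn ℂ (fun z : ℂ => ∫ s : ℝ, (g s : ℂ) / ((s : ℂ) - z)) {z : ℂ | 0 < z.im} := by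
  intro z₀ (hz₀ : 0 < z₀.im)
  set r : ℝ := z₀.im / 2 with hr
  have hr0 : 0 < r := by positivity
  have him : ∀ z ∈ Metric.ball z₀ r, r < z.im := by
    intro z hz
    have h1 : |(z - z₀).im| < r :=
      (Complex.abs_im_le_norm _).trans_lt (by simpa [dist_eq_norm] using hz)
    rw [Complex.sub_im] at h1
    have := (abs_lt.1 h1).1
    linarith
  have key := hasDerivAt_integral_of_dominated_loc_of_deriv_le (μ := (volume : Measure ℝ))
    (F := fun (z : ℂ) (s : ℝ) => (g s : ℂ) / ((s : ℂ) - z))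
    (F' := fun (z : ℂ) (s : ℝ) => (g s : ℂ) / ((s : ℂ) - z) ^ 2) (x₀ := z₀)
    (bound := fun s => |g s| / r ^ 2) (Metric.ball_mem_nhds z₀ hr0) ?_
    (integrable_cauchyKernel hg hs hz₀) ?_ ?_ ?_ ?_
  · exact key.2.differentiableAt.differentiableWithinAt
  · filter_upwards [Metric.ball_mem_nhds z₀ hr0] with z hz
    exact (continuous_cauchyKernel hg (hr0.trans (him z hz))).aestronglyMeasurable
  · exact ((continuous_ofReal.comp hg).div ((continuous_ofReal.sub continuous_const).pow 2)
      fun s => pow_ne_zero 2 (ofReal_sub_ne_zero_of_im_pos hz₀ s)).aestronglyMeasurable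
  · refine Eventually.of_forall fun s z hz => ?_
    have h1 : r ≤ ‖(s : ℂ) - z‖ := by
      have := Complex.abs_im_le_norm ((s : ℂ) - z)
      simp only [Complex.sub_im, Complex.ofReal_im, zero_sub, abs_neg] at this
      exact ((him z hz).le.trans (le_abs_self _)).trans this
    rw [norm_div, norm_pow, Complex.norm_real, Real.norm_eq_abs]
    gcongr
  · exact (hg.integrable_of_hasCompactSupport hs).abs.div_const _
  · refine Eventually.of_forall fun s z hz => ?_
    have hne := ofReal_sub_ne_zero_of_im_pos (hr0.trans (him z hz)) s
    have h := ((hasDerivAt_id z).const_sub (s : ℂ)).inv hne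
    have h' := h.const_mul (g s : ℂ)
    simpa [div_eq_mul_inv] using h'

theorem ofReal_div_ofReal_sub_re (a s x y : ℝ) :
    ((a : ℂ) / ((s : ℂ) - (x + y * I))).re = a * ((s - x) / ((s - x) ^ 2 + y ^ 2)) := by
  simp [Complex.div_re, Complex.normSq_apply]
  ring_nf

theorem ofReal_div_ofReal_sub_im (a s x y : ℝ) :
    ((a : ℂ) / ((s : ℂ) - (x + y * I))).im = a * (y / ((s - x) ^ 2 + y ^ 2)) := by
  simp [Complex.div_im, Complex.normSq_apply]
  ring_nf

theorem re_integral_cauchyKernel (hg : Continuous g) (hs : HasCompactSupport g) (x : ℝ) {y : ℝ}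
    (hy : 0 < y) :
    (∫ s : ℝ, (g s : ℂ) / ((s : ℂ) - (x + y * I))).re =
      ∫ t : ℝ, g (x + t) * (t / (t ^ 2 + y ^ 2)) := by
  have hint := integrable_cauchyKernel hg hs (z := x + y * I) (by simpa using hy)
  have h := integral_re hint
  simp only [RCLike.re_to_complex] at h
  rw [← h, ← integral_add_left_eq_self _ x]
  refine integral_congr_ae (Eventually.of_forall fun t => ?_)
  simp only [ofReal_div_ofReal_sub_re, add_sub_cancel_left]

theorem im_integral_cauchyKernel (hg : Continuous g) (hs : HasCompactSupport g) (x : ℝ) {y : ℝ}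
    (hy : 0 < y) :
    (∫ s : ℝ, (g s : ℂ) / ((s : ℂ) - (x + y * I))).im =
      ∫ u : ℝ, g (x + y * u) * (1 + u ^ 2)⁻¹ := by
  have hint := integrable_cauchyKernel hg hs (z := x + y * I) (by simpa using hy)
  have h := integral_im hint
  simp only [RCLike.im_to_complex] at h
  rw [← h, ← integral_add_left_eq_self _ x]
  have h2 := Measure.integral_comp_mul_left
    (fun t : ℝ => ((g (x + t) : ℂ) / (((x + t : ℝ) : ℂ) - (x + y * I))).im) y
  rw [abs_of_pos (inv_pos.2 hy), smul_eq_mul, eq_inv_mul_iff_mul_eq₀ hy.ne'] at h2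
  rw [← h2, ← integral_const_mul]
  refine integral_congr_ae (Eventually.of_forall fun u => ?_)
  simp only [ofReal_div_ofReal_sub_im, add_sub_cancel_left]
  have : 0 < 1 + u ^ 2 := by positivity
  field_simp
  ring

theorem integral_eq_half_integral_add_neg {F : ℝ → ℝ} (hF : Integrable F) :
    ∫ t, F t = (1 / 2) * ∫ t, (F t + F (-t)) := by
  rw [integral_add hF hF.comp_neg, integral_neg_eq_self]
  ring

/-- When `g` is moreover integrable, the right-hand side is an integrable function of `t` whose
integral does not depend on `x`. -/
theorem abs_symm_quotient_le {K : NNReal} (hL : LipschitzWith K g) (x t : ℝ) :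
    |(g (x + t) - g (x - t)) / t| ≤
      (Icc (-1) 1).indicator (fun _ => 2 * (K : ℝ)) t + (|g (x + t)| + |g (x - t)|) := by
  rw [abs_div]
  by_cases ht : t ∈ Icc (-1 : ℝ) 1
  · rw [indicator_of_mem ht]
    have h := hL.dist_le_mul (x + t) (x - t)
    rw [Real.dist_eq, Real.dist_eq, show x + t - (x - t) = 2 * t by ring, abs_mul, abs_two] at h
    have : |g (x + t) - g (x - t)| / |t| ≤ 2 * K :=
      div_le_of_le_mul₀ (abs_nonneg _) (by positivity) (by linarith)
    have := abs_nonneg (g (x + t))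
    have := abs_nonneg (g (x - t))
    linarith
  · rw [indicator_of_notMem ht, zero_add]
    have h1 : 1 ≤ |t| := by
      by_contra! h
      exact ht ⟨(abs_lt.1 h).1.le, (abs_lt.1 h).2.le⟩
    exact (div_le_self (abs_nonneg _) h1).trans (abs_sub _ _)

theorem integrable_symm_quotient_bound (hg : Integrable g) (c x : ℝ) :
    Integrable fun t => (Icc (-1) 1).indicator (fun _ => c) t + (|g (x + t)| + |g (x - t)|) := by
  refine Integrable.add ?_ ((hg.comp_add_left x).abs.add (hg.comp_sub_left x).abs)
  exact (integrable_indicator_iff measurableSet_Icc).2 (integrableOn_const (by simp))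

theorem integral_symm_quotient_bound (hg : Integrable g) (c x : ℝ) :
    ∫ t, ((Icc (-1) 1).indicator (fun _ => c) t + (|g (x + t)| + |g (x - t)|)) =
      2 * c + 2 * ∫ t, |g t| := by
  have hi : Integrable ((Icc (-1 : ℝ) 1).indicator (fun _ => c)) :=
    (integrable_indicator_iff measurableSet_Icc).2 (integrableOn_const (by simp))
  have hj : Integrable fun t => |g (x + t)| + |g (x - t)| :=
    (hg.comp_add_left x).abs.add (hg.comp_sub_left x).abs
  rw [integral_add hi hj, integral_add (hg.comp_add_left x).abs (hg.comp_sub_left x).abs,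
    integral_add_left_eq_self (fun t => |g t|) x,
    integral_sub_left_eq_self (fun t => |g t|) volume x, integral_indicator measurableSet_Icc]
  simp
  ring

theorem integral_conjPoisson_eq (hg : Continuous g) (hs : HasCompactSupport g) (x : ℝ) {y : ℝ}
    (hy : 0 < y) :
    ∫ t : ℝ, g (x + t) * (t / (t ^ 2 + y ^ 2)) =
      (1 / 2) * ∫ t : ℝ, (g (x + t) - g (x - t)) / t * (t ^ 2 / (t ^ 2 + y ^ 2)) := by
  have hint : Integrable fun t : ℝ => g (x + t) * (t / (t ^ 2 + y ^ 2)) := by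
    have hc : Continuous fun t : ℝ => g (x + t) * (t / (t ^ 2 + y ^ 2)) :=
      (hg.comp (continuous_const.add continuous_id)).mul
        (continuous_id.div (by fun_prop) fun t => by positivity)
    exact hc.integrable_of_hasCompactSupport
      ((hs.comp_homeomorph (Homeomorph.addLeft x)).mul_right)
  rw [integral_eq_half_integral_add_neg hint]
  congr 1
  refine integral_congr_ae (Eventually.of_forall fun t => ?_)
  have : 0 < t ^ 2 + y ^ 2 := by positivity
  rcases eq_or_ne t 0 with rfl | ht
  · simp
  · simp only [neg_sq, ← sub_eq_add_neg]
    field_simp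
    ring

theorem abs_sq_div_sq_add_sq_le_one (t y : ℝ) : |t ^ 2 / (t ^ 2 + y ^ 2)| ≤ 1 := by
  rw [abs_of_nonneg (by positivity)]
  exact div_le_one_of_le₀ (by nlinarith [sq_nonneg y]) (by positivity)

theorem abs_integral_conjPoisson_le {K : NNReal} (hL : LipschitzWith K g)
    (hs : HasCompactSupport g) (x : ℝ) {y : ℝ} (hy : 0 < y) :
    |∫ t : ℝ, g (x + t) * (t / (t ^ 2 + y ^ 2))| ≤ 2 * K + ∫ t, |g t| := by
  have hgi := hL.continuous.integrable_of_hasCompactSupport hs (μ := volume)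
  rw [integral_conjPoisson_eq hL.continuous hs x hy, abs_mul]
  have h := norm_integral_le_of_norm_le
    (f := fun t : ℝ => (g (x + t) - g (x - t)) / t * (t ^ 2 / (t ^ 2 + y ^ 2)))
    (integrable_symm_quotient_bound hgi (2 * (K : ℝ)) x)
    (Eventually.of_forall fun t => ?_)
  · rw [integral_symm_quotient_bound hgi, Real.norm_eq_abs] at h
    rw [abs_of_pos (by norm_num : (0 : ℝ) < 1 / 2)]
    linarith
  · rw [Real.norm_eq_abs, abs_mul]
    exact (mul_le_of_le_one_right (abs_nonneg _) (abs_sq_div_sq_add_sq_le_one t y)).trans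
      (abs_symm_quotient_le hL x t)

theorem measurable_symm_quotient (hg : Continuous g) (x : ℝ) :
    Measurable fun t : ℝ => (g (x + t) - g (x - t)) / t :=
  ((hg.comp (continuous_const.add continuous_id)).measurable.sub
    (hg.comp (continuous_const.sub continuous_id)).measurable).div measurable_id

theorem tendsto_integral_conjPoisson {K : NNReal} (hL : LipschitzWith K g)
    (hs : HasCompactSupport g) (x : ℝ) :
    Tendsto (fun y : ℝ => ∫ t : ℝ, g (x + t) * (t / (t ^ 2 + y ^ 2))) (𝓝[>] 0)
      (𝓝 ((1 / 2) * ∫ t : ℝ, (g (x + t) - g (x - t)) / t)) := by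
  have hgi := hL.continuous.integrable_of_hasCompactSupport hs (μ := volume)
  have h : Tendsto (fun y : ℝ => ∫ t : ℝ, (g (x + t) - g (x - t)) / t * (t ^ 2 / (t ^ 2 + y ^ 2)))
      (𝓝[>] 0) (𝓝 (∫ t : ℝ, (g (x + t) - g (x - t)) / t)) := by
    refine tendsto_integral_filter_of_dominated_convergence _ ?_ ?_
      (integrable_symm_quotient_bound hgi (2 * (K : ℝ)) x) ?_
    · refine Eventually.of_forall fun y => ?_
      exact ((measurable_symm_quotient hL.continuous x).mul (by fun_prop)).aestronglyMeasurable
    · refine Eventually.of_forall fun y => Eventually.of_forall fun t => ?_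
      rw [Real.norm_eq_abs, abs_mul]
      exact (mul_le_of_le_one_right (abs_nonneg _) (abs_sq_div_sq_add_sq_le_one t y)).trans
        (abs_symm_quotient_le hL x t)
    · refine Eventually.of_forall fun t => ?_
      rcases eq_or_ne t 0 with rfl | ht
      · simp
      · have hc : ContinuousAt
            (fun y : ℝ => (g (x + t) - g (x - t)) / t * (t ^ 2 / (t ^ 2 + y ^ 2))) 0 :=
          continuousAt_const.mul (continuousAt_const.div (by fun_prop) (by positivity))
        have h0 := hc.tendsto.mono_left (nhdsWithin_le_nhds (s := Ioi 0))
        simpa [ht] using h0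
  refine (h.const_mul (1 / 2)).congr' ?_
  filter_upwards [self_mem_nhdsWithin] with y hy
  exact (integral_conjPoisson_eq hL.continuous hs x hy).symm

theorem setIntegral_truncated_hilbert_eq (hg : Integrable g) (x : ℝ) {ε : ℝ} (hε : 0 < ε) :
    ∫ s in {s : ℝ | ε < |x - s|}, g s / (x - s) =
      -((1 / 2) * ∫ t, {t : ℝ | ε < |t|}.indicator (fun t => (g (x + t) - g (x - t)) / t) t) := by
  have hm : MeasurableSet {t : ℝ | ε < |t|} := measurableSet_lt measurable_const measurable_abs
  have hm' : MeasurableSet {s : ℝ | ε < |x - s|} :=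
    measurableSet_lt measurable_const (by fun_prop)
  have hint : Integrable ({t : ℝ | ε < |t|}.indicator fun t => g (x + t) / t) := by
    refine ((hg.comp_add_left x).norm.const_mul ε⁻¹).mono' ?_ (Eventually.of_forall fun t => ?_)
    · exact ((hg.comp_add_left x).aestronglyMeasurable.mul
        measurable_inv.aestronglyMeasurable).indicator hm
    · by_cases ht : ε < |t|
      · rw [indicator_of_mem (by exact ht), norm_div, div_eq_inv_mul]
        gcongr
        exact ht.le
      · rw [indicator_of_notMem (by exact ht), norm_zero]
        positivity
  rw [← integral_indicator hm', ← integral_add_left_eq_self _ x]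
  have h1 : ∀ t, {s : ℝ | ε < |x - s|}.indicator (fun s => g s / (x - s)) (x + t) =
      -{t : ℝ | ε < |t|}.indicator (fun t => g (x + t) / t) t := by
    intro t
    by_cases ht : ε < |t|
    · rw [indicator_of_mem (by simpa using ht), indicator_of_mem (by exact ht)]
      simp [div_neg]
    · rw [indicator_of_notMem (by simpa using ht), indicator_of_notMem (by exact ht), neg_zero]
  simp only [h1]
  rw [integral_neg, integral_eq_half_integral_add_neg hint]
  congr 3
  funext t
  by_cases ht : ε < |t|
  · rw [indicator_of_mem (by exact ht), indicator_of_mem (by simpa using ht),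
      indicator_of_mem (by exact ht)]
    rw [div_neg, ← sub_eq_add_neg, ← sub_eq_add_neg, sub_div]
  · rw [indicator_of_notMem (by exact ht), indicator_of_notMem (by simpa using ht),
      indicator_of_notMem (by exact ht), add_zero]

theorem HT_eq_integral_symm_quotient {K : NNReal} (hL : LipschitzWith K g)
    (hs : HasCompactSupport g) (x : ℝ) :
    HT g x = (1 / Real.pi) * ((1 / 2) * ∫ t : ℝ, (g (x + t) - g (x - t)) / t) := by
  have hgi := hL.continuous.integrable_of_hasCompactSupport hs (μ := volume)
  refine Tendsto.limUnder_eq ?_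
  have h : Tendsto (fun ε : ℝ => ∫ t, {t : ℝ | ε < |t|}.indicator
      (fun t => (g (x + t) - g (x - t)) / t) t)
      (𝓝[>] 0) (𝓝 (∫ t : ℝ, (g (x + t) - g (x - t)) / t)) := by
    refine tendsto_integral_filter_of_dominated_convergence _ ?_ ?_
      (integrable_symm_quotient_bound hgi (2 * (K : ℝ)) x) ?_
    · refine Eventually.of_forall fun ε => ?_
      exact ((measurable_symm_quotient hL.continuous x).indicator
        (measurableSet_lt measurable_const measurable_abs)).aestronglyMeasurable
    · refine Eventually.of_forall fun ε => Eventually.of_forall fun t => ?_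
      exact (norm_indicator_le_norm_self _ t).trans (abs_symm_quotient_le hL x t)
    · refine Eventually.of_forall fun t => ?_
      refine tendsto_const_nhds.congr' ?_
      rcases eq_or_ne t 0 with rfl | ht
      · exact Eventually.of_forall fun ε => by simp [indicator]
      · filter_upwards [Ioo_mem_nhdsGT (abs_pos.2 ht)] with ε hε
        rw [indicator_of_mem (by exact hε.2)]
  refine ((h.const_mul (1 / 2)).const_mul (1 / Real.pi)).congr' ?_
  filter_upwards [self_mem_nhdsWithin] with ε hε
  rw [setIntegral_truncated_hilbert_eq hgi x hε]
  ring

theorem integrable_comp_mul_inv_one_add_sq (hg : Continuous g) {M : ℝ} (hM : ∀ s, |g s| ≤ M)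
    (x y : ℝ) : Integrable fun u : ℝ => g (x + y * u) * (1 + u ^ 2)⁻¹ :=
  integrable_inv_one_add_sq.bdd_mul (c := M)
    (hg.comp (by fun_prop : Continuous fun u : ℝ => x + y * u)).aestronglyMeasurable
    (Eventually.of_forall fun u => hM _)

theorem tendsto_integral_poisson (hg : Continuous g) {M : ℝ} (hM : ∀ s, |g s| ≤ M) (x : ℝ) :
    Tendsto (fun y : ℝ => ∫ u : ℝ, g (x + y * u) * (1 + u ^ 2)⁻¹) (𝓝[>] 0) (𝓝 (g x * π)) := by
  rw [← integral_univ_inv_one_add_sq, ← integral_const_mul]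
  refine tendsto_integral_filter_of_dominated_convergence (fun u => M * (1 + u ^ 2)⁻¹) ?_ ?_
    (integrable_inv_one_add_sq.const_mul M) ?_
  · exact Eventually.of_forall fun y =>
      (integrable_comp_mul_inv_one_add_sq hg hM x y).aestronglyMeasurable
  · refine Eventually.of_forall fun y => Eventually.of_forall fun u => ?_
    have : 0 < (1 + u ^ 2)⁻¹ := by positivity
    rw [Real.norm_eq_abs, abs_mul, abs_of_pos this]
    exact mul_le_mul_of_nonneg_right (hM _) this.le
  · refine Eventually.of_forall fun u => ?_
    have hc : Continuous fun y : ℝ => g (x + y * u) * (1 + u ^ 2)⁻¹ :=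
      (hg.comp (by fun_prop)).mul continuous_const
    simpa using (hc.tendsto 0).mono_left (nhdsWithin_le_nhds (s := Ioi 0))

theorem integral_poisson_mem_Icc (hg : Continuous g) {a b : ℝ} (hab : ∀ s, g s ∈ Icc a b)
    (x y : ℝ) : (1 / π) * ∫ u : ℝ, g (x + y * u) * (1 + u ^ 2)⁻¹ ∈ Icc a b := by
  have hM : ∀ s, |g s| ≤ max |a| |b| := fun s => abs_le_max_abs_abs (hab s).1 (hab s).2
  have hi := integrable_comp_mul_inv_one_add_sq hg hM x y
  have hconst : ∀ c : ℝ, ∫ u : ℝ, c * (1 + u ^ 2)⁻¹ = c * π := fun c => by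
    rw [integral_const_mul, integral_univ_inv_one_add_sq]
  have hpos : ∀ u : ℝ, 0 ≤ (1 + u ^ 2)⁻¹ := fun u => by positivity
  have h1 := integral_mono (integrable_inv_one_add_sq.const_mul a) hi
    fun u => mul_le_mul_of_nonneg_right (hab (x + y * u)).1 (hpos u)
  have h2 := integral_mono hi (integrable_inv_one_add_sq.const_mul b)
    fun u => mul_le_mul_of_nonneg_right (hab (x + y * u)).2 (hpos u)
  simp only [hconst] at h1 h2
  rw [one_div_mul_eq_div]
  exact ⟨(le_div_iff₀ Real.pi_pos).2 h1, (div_le_iff₀ Real.pi_pos).2 h2⟩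

end CauchyTransform

theorem lipschitzWith_arctan : LipschitzWith 1 Real.arctan := by
  refine lipschitzWith_of_nnnorm_deriv_le Real.differentiable_arctan fun x => ?_
  rw [← NNReal.coe_le_coe, coe_nnnorm, Real.deriv_arctan, Real.norm_eq_abs,
    abs_of_pos (by positivity)]
  exact div_le_one_of_le₀ (by nlinarith [sq_nonneg x]) (by positivity)

theorem exp_im_div_exp_re (w : ℂ) :
    (Complex.exp w).im / (Complex.exp w).re = Real.tan w.im := by
  rw [Complex.exp_im, Complex.exp_re, mul_div_mul_left _ _ (Real.exp_pos _).ne',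
    Real.tan_eq_sin_div_cos]

/-- Properties of `φ(z) = (1/π)∫ arctan f̄(s)/(s-z) ds` for a
compactly supported Lipschitz `f̄`: holomorphy on the upper half-plane, a.e.
boundary values `τ̄(x) + i·arctan f̄(x)`, positivity and two-sided bounds for
`Re e^{φ}`, and the bounds `inf f̄ ≤ Im e^{φ}/Re e^{φ} ≤ sup f̄`. -/
theorem stmt12 (f : ℝ → ℝ) (K : NNReal)
    (hf_lip : LipschitzWith K f) (hf_supp : HasCompactSupport f)
    (τb : ℝ → ℝ) (hτb : τb = HT (fun s => Real.arctan (f s)))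
    (φ : ℂ → ℂ)
    (hφ : ∀ z : ℂ, φ z = (1 / (Real.pi : ℂ)) *
      ∫ s : ℝ, ((Real.arctan (f s) : ℝ) : ℂ) / ((s : ℂ) - z)) :
    -- (a)
    DifferentiableOn ℂ φ {z : ℂ | 0 < z.im} ∧
    -- (b)
    (∀ᵐ (x : ℝ) ∂(volume : Measure ℝ),
      Tendsto (fun y : ℝ => φ (Complex.ofReal x + Complex.ofReal y * Complex.I))
        (𝓝[>] (0:ℝ))
        (𝓝 (Complex.ofReal (τb x) +
          Complex.ofReal (Real.arctan (f x)) * Complex.I))) ∧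
    -- (c)
    (∀ z : ℂ, 0 < z.im → 0 < (Complex.exp (φ z)).re ∧
      sInf (Set.range f) ≤ (Complex.exp (φ z)).im / (Complex.exp (φ z)).re ∧
      (Complex.exp (φ z)).im / (Complex.exp (φ z)).re ≤ sSup (Set.range f)) ∧
    -- (d)
    (∃ C₁ C₂ : ℝ, 0 < C₁ ∧ ∀ z : ℂ, 0 < z.im →
      C₁ ≤ (Complex.exp (φ z)).re ∧ (Complex.exp (φ z)).re ≤ C₂) := by
  set g : ℝ → ℝ := fun s => Real.arctan (f s)
  have hL : LipschitzWith (1 * K) g := lipschitzWith_arctan.comp hf_lip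
  have hc : Continuous g := hL.continuous
  have hs : HasCompactSupport g := hf_supp.comp_left Real.arctan_zero
  have hcomp : IsCompact (range f) := hf_supp.isCompact_range hf_lip.continuous
  have hmem : ∀ s, g s ∈ Icc (Real.arctan (sInf (range f))) (Real.arctan (sSup (range f))) :=
    fun s => ⟨Real.arctan_mono (csInf_le hcomp.bddBelow (mem_range_self s)),
      Real.arctan_mono (le_csSup hcomp.bddAbove (mem_range_self s))⟩
  have hM : ∀ s, |g s| ≤ π / 2 := fun s =>
    abs_le.2 ⟨(Real.neg_pi_div_two_lt_arctan _).le, (Real.arctan_lt_pi_div_two _).le⟩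
  have hφre : ∀ (x : ℝ) {y : ℝ}, 0 < y → (φ (x + y * I)).re =
      (1 / π) * ∫ t : ℝ, g (x + t) * (t / (t ^ 2 + y ^ 2)) := by
    intro x y hy
    rw [hφ, ← re_integral_cauchyKernel hc hs x hy, ← ofReal_one, ← ofReal_div, re_ofReal_mul]
  have hφim : ∀ (x : ℝ) {y : ℝ}, 0 < y → (φ (x + y * I)).im =
      (1 / π) * ∫ u : ℝ, g (x + y * u) * (1 + u ^ 2)⁻¹ := by
    intro x y hy
    rw [hφ, ← im_integral_cauchyKernel hc hs x hy, ← ofReal_one, ← ofReal_div, im_ofReal_mul]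
  have him : ∀ z : ℂ, 0 < z.im →
      (φ z).im ∈ Icc (Real.arctan (sInf (range f))) (Real.arctan (sSup (range f))) := by
    intro z hz
    rw [← re_add_im z, hφim _ hz]
    exact integral_poisson_mem_Icc hc hmem _ _
  have hre : ∀ z : ℂ, 0 < z.im →
      |(φ z).re| ≤ (1 / π) * (2 * ((1 * K : NNReal) : ℝ) + ∫ t, |g t|) := by
    intro z hz
    rw [← re_add_im z, hφre _ hz, abs_mul, abs_of_pos (by positivity : 0 < 1 / π)]
    exact mul_le_mul_of_nonneg_left (abs_integral_conjPoisson_le hL hs _ hz) (by positivity)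
  set a := sInf (range f)
  set b := sSup (range f)
  have him' : ∀ z : ℂ, 0 < z.im → (φ z).im ∈ Ioo (-(π / 2)) (π / 2) := fun z hz =>
    ⟨(Real.neg_pi_div_two_lt_arctan _).trans_le (him z hz).1,
      (him z hz).2.trans_lt (Real.arctan_lt_pi_div_two _)⟩
  refine ⟨?_, ?_, ?_, ?_⟩
  · rw [funext hφ]
    exact (differentiableOn_integral_cauchyKernel hc hs).const_mul _
  · refine Eventually.of_forall fun x => ?_
    have h1 := (tendsto_integral_conjPoisson hL hs x).const_mul (1 / π)
    rw [← HT_eq_integral_symm_quotient hL hs x, ← hτb] at h1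
    have h2 := (tendsto_integral_poisson hc hM x).const_mul (1 / π)
    rw [show 1 / π * (g x * π) = g x by field_simp] at h2
    refine (((continuous_ofReal.tendsto _).comp h1).add
      (((continuous_ofReal.tendsto _).comp h2).mul_const I)).congr' ?_
    filter_upwards [self_mem_nhdsWithin] with y hy
    rw [Function.comp_apply, Function.comp_apply, ← hφre x hy, ← hφim x hy, re_add_im]
  · intro z hz
    have hmono := Real.strictMonoOn_tan.monotoneOn
    refine ⟨?_, ?_, ?_⟩
    · rw [Complex.exp_re]
      exact mul_pos (Real.exp_pos _) (Real.cos_pos_of_mem_Ioo (him' z hz))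
    · rw [exp_im_div_exp_re, ← Real.tan_arctan a]
      exact hmono (Real.arctan_mem_Ioo a) (him' z hz) (him z hz).1
    · rw [exp_im_div_exp_re, ← Real.tan_arctan b]
      exact hmono (him' z hz) (Real.arctan_mem_Ioo b) (him z hz).2
  · set C := (1 / π) * (2 * ((1 * K : NNReal) : ℝ) + ∫ t, |g t|)
    set M := max |Real.arctan a| |Real.arctan b|
    have hMlt : M < π / 2 := max_lt
      (abs_lt.2 ⟨Real.neg_pi_div_two_lt_arctan _, Real.arctan_lt_pi_div_two _⟩)
      (abs_lt.2 ⟨Real.neg_pi_div_two_lt_arctan _, Real.arctan_lt_pi_div_two _⟩)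
    have hM0 : 0 ≤ M := (abs_nonneg _).trans (le_max_left _ _)
    have hcosM : 0 < Real.cos M := Real.cos_pos_of_mem_Ioo ⟨by linarith [Real.pi_pos], hMlt⟩
    refine ⟨Real.exp (-C) * Real.cos M, Real.exp C, by positivity, fun z hz => ?_⟩
    have hC := abs_le.1 (hre z hz)
    have hcos : Real.cos M ≤ Real.cos (φ z).im := by
      rw [← Real.cos_abs (φ z).im]
      exact Real.cos_le_cos_of_nonneg_of_le_pi (abs_nonneg _) (by linarith [Real.pi_pos])
        (abs_le_max_abs_abs (him z hz).1 (him z hz).2)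
    rw [Complex.exp_re]
    constructor
    · exact mul_le_mul (Real.exp_le_exp.2 hC.1) hcos hcosM.le (Real.exp_pos _).le
    · exact (mul_le_of_le_one_right (Real.exp_pos _).le (Real.cos_le_one _)).trans
        (Real.exp_le_exp.2 hC.2)
end
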